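/- Superadditivity of S_k^{1/k}: for Hermitian n×n matrices A and B whose eigenvalue vectors both lie in the closed cone Γ̄_k, one has S_k(A+B)^{1/k} ≥ S_k(A)^{1/k} + S_k(B)^{1/k}, where S_k of a Hermitian matrix means S_k of its eigenvalues (equivalently, the sum of its k×k principal minors). -/

import Mathlib

open scoped BigOperators
noncomputable section

/-- The `k`-th elementary symmetric function of `lam` over an index set `s`. -/
def esymmOn {n : ℕ} (s : Finset (Fin n)) (k : ℕ) (lam : Fin n → ℝ) : ℝ :=
  ∑ t ∈ s.powersetCard k, ∏ i ∈ t, lam i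

/-- The `k`-th elementary symmetric polynomial `S_k` on `ℝ^n`. -/
def esymm' (n k : ℕ) (lam : Fin n → ℝ) : ℝ := esymmOn Finset.univ k lam

/-- The Gårding cone `Γ_k = {λ : S_i(λ) > 0, 1 ≤ i ≤ k}`. -/
def Gamma (n k : ℕ) : Set (Fin n → ℝ) :=
  {lam | ∀ i : ℕ, 1 ≤ i → i ≤ k → 0 < esymm' n i lam}

section helpers
variable {n : ℕ}

lemma E_zero (s : Finset (Fin n)) (x : Fin n → ℝ) : esymmOn s 0 x = 1 := by
  simp [esymmOn]

lemma E_insert {s : Finset (Fin n)} {i : Fin n} (hi : i ∉ s) (k : ℕ) (x : Fin n → ℝ) :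
    esymmOn (insert i s) (k + 1) x = esymmOn s (k + 1) x + x i * esymmOn s k x := by
  unfold esymmOn
  rw [Finset.powersetCard_succ_insert hi, Finset.sum_union, Finset.sum_image, Finset.mul_sum]
  · congr 1
    refine Finset.sum_congr rfl fun t ht => ?_
    rw [Finset.prod_insert]
    exact fun h => hi ((Finset.mem_powersetCard.1 ht).1 h)
  · intro a ha b hb hab
    have ha' : i ∉ a := fun h => hi ((Finset.mem_powersetCard.1 ha).1 h)
    have hb' : i ∉ b := fun h => hi ((Finset.mem_powersetCard.1 hb).1 h)
    have := congrArg (fun t => Finset.erase t i) hab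
    simpa [Finset.erase_insert ha', Finset.erase_insert hb'] using this
  · rw [Finset.disjoint_left]
    intro a ha hb
    obtain ⟨b, _, rfl⟩ := Finset.mem_image.1 hb
    exact hi ((Finset.mem_powersetCard.1 ha).1 (Finset.mem_insert_self _ _))

lemma E_erase {s : Finset (Fin n)} {i : Fin n} (hi : i ∈ s) (k : ℕ) (x : Fin n → ℝ) :
    esymmOn s (k + 1) x = esymmOn (s.erase i) (k + 1) x + x i * esymmOn (s.erase i) k x := by
  conv_lhs => rw [← Finset.insert_erase hi]
  exact E_insert (Finset.notMem_erase _ _) k x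

lemma E_euler (s : Finset (Fin n)) (x : Fin n → ℝ) : ∀ k : ℕ,
    ∑ i ∈ s, x i * esymmOn (s.erase i) k x = (k + 1) * esymmOn s (k + 1) x := by
  induction s using Finset.induction_on with
  | empty => intro k; rw [esymmOn, Finset.powersetCard_eq_empty.2 (by simp)]; simp
  | insert a s ha ih =>
    intro k
    rw [Finset.sum_insert ha, Finset.erase_insert ha]
    have key : ∀ i ∈ s, (insert a s).erase i = insert a (s.erase i) := by
      intro i hi
      rw [Finset.erase_insert_of_ne]
      rintro rfl; exact ha hi
    have ha' : ∀ i, a ∉ s.erase i := fun i h => ha (Finset.mem_of_mem_erase h)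
    rw [Finset.sum_congr rfl fun i hi => by rw [key i hi]]
    cases k with
    | zero =>
      have := ih 0
      simp only [E_zero] at this ⊢
      rw [this, E_insert ha, E_zero]
      push_cast; ring
    | succ k =>
      simp only [E_insert (ha' _), E_insert ha]
      have h1 := ih (k + 1)
      have h2 := ih k
      have : ∑ i ∈ s, x i * (esymmOn (s.erase i) (k + 1) x + x a * esymmOn (s.erase i) k x)
        = ∑ i ∈ s, x i * esymmOn (s.erase i) (k + 1) x
          + x a * ∑ i ∈ s, x i * esymmOn (s.erase i) k x := by
        rw [Finset.mul_sum, ← Finset.sum_add_distrib]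
        exact Finset.sum_congr rfl fun i _ => by ring
      rw [this, h1, h2]; push_cast; ring

open Polynomial in
lemma splits_deriv (p : ℝ[X]) (hp : p.Splits) : (derivative p).Splits := by
  rw [splits_iff_card_roots] at hp ⊢
  have h1 := card_roots_le_derivative p
  have h2 := natDegree_derivative_le p
  have h3 := card_roots' (derivative p)
  rcases Nat.eq_zero_or_pos p.natDegree with h | h
  · omega
  · omega

open Polynomial in
lemma laguerre_prod (t : ℝ) (m : Multiset ℝ) :
    (m.map (fun a => X - C a)).prod.eval t *
      (derivative (derivative (m.map (fun a => X - C a)).prod)).eval t ≤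
      ((derivative (m.map (fun a => X - C a)).prod).eval t) ^ 2 := by
  induction m using Multiset.induction_on with
  | empty => simp
  | cons a m ih =>
    rw [Multiset.map_cons, Multiset.prod_cons]
    set q := (m.map (fun a => X - C a)).prod
    simp only [derivative_mul, derivative_sub, derivative_X, derivative_C, eval_add, eval_mul,
      eval_sub, eval_X, eval_C, derivative_add, sub_zero, one_mul]
    nlinarith [mul_le_mul_of_nonneg_left ih (sq_nonneg (t - a)), sq_nonneg (q.eval t)]

open Polynomial in
lemma laguerre (p : ℝ[X]) (hp : p.Splits) (t : ℝ) :
    p.eval t * (derivative (derivative p)).eval t ≤ ((derivative p).eval t) ^ 2 := by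
  have h := hp.eq_prod_roots
  have h2 := laguerre_prod t p.roots
  set q := (p.roots.map (fun a => X - C a)).prod
  rw [h]
  simp only [derivative_mul, derivative_C, zero_mul, zero_add, eval_mul, eval_C]
  nlinarith [mul_le_mul_of_nonneg_left h2 (sq_nonneg (p.leadingCoeff))]

open Polynomial in
lemma newton (s : Finset (Fin n)) (k : ℕ) (x : Fin n → ℝ) :
    esymmOn s (k + 2) x * esymmOn s k x ≤ esymmOn s (k + 1) x ^ 2 := by
  by_cases hs : s.card < k + 2
  · have : esymmOn s (k + 2) x = 0 := by
      unfold esymmOn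
      rw [Finset.powersetCard_eq_empty.2 hs]; simp
    rw [this]; nlinarith [sq_nonneg (esymmOn s (k + 1) x)]
  obtain ⟨m, hm⟩ := Nat.exists_eq_add_of_le (not_lt.1 hs)
  set P : ℝ[X] := ∏ i ∈ s, (X + C (x i)) with hP
  have hPs : P.Splits := by
    apply Splits.prod
    intro i _
    exact Splits.X_add_C _
  have hsp : ∀ j, (derivative^[j] P).Splits := by
    intro j
    induction j with
    | zero => exact hPs
    | succ j ih => rw [Function.iterate_succ_apply']; exact splits_deriv _ ih
  have h := laguerre _ (hsp m) 0
  rw [← Function.iterate_succ_apply' derivative, ← Function.iterate_succ_apply' derivative] at h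
  simp only [← coeff_zero_eq_eval_zero, coeff_iterate_derivative, zero_add, Nat.descFactorial_self,
    nsmul_eq_mul] at h
  rw [hP, Finset.prod_X_add_C_coeff _ _ (by omega), Finset.prod_X_add_C_coeff _ _ (by omega),
    Finset.prod_X_add_C_coeff _ _ (by omega), show s.card - m = k + 2 by omega,
    show s.card - (m + 1) = k + 1 by omega, show s.card - (m + 1 + 1) = k by omega] at h
  change _ * esymmOn s (k + 2) x * (_ * esymmOn s k x) ≤ (_ * esymmOn s (k + 1) x) ^ 2 at h
  simp only [Nat.succ_eq_add_one, Nat.factorial_succ] at h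
  have hf : (0 : ℝ) < m.factorial := by positivity
  push_cast at h
  set f : ℝ := (m.factorial : ℝ)
  generalize esymmOn s (k + 2) x = e2 at *
  generalize esymmOn s (k + 1) x = e1 at *
  generalize esymmOn s k x = e0 at *
  have hm0 : (0 : ℝ) ≤ m := by positivity
  have h' : f ^ 2 * (m + 1) * ((m + 2) * (e2 * e0)) ≤ f ^ 2 * (m + 1) * ((m + 1) * e1 ^ 2) := by
    nlinarith
  have h'' := le_of_mul_le_mul_left h' (by positivity)
  by_contra hc
  push Not at hc
  nlinarith [sq_nonneg e1]

/-- cone over an index set -/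
def G (s : Finset (Fin n)) (k : ℕ) (x : Fin n → ℝ) : Prop := ∀ j ≤ k, 0 < esymmOn s j x

lemma G_erase {s : Finset (Fin n)} {i : Fin n} (hi : i ∈ s) (x : Fin n → ℝ) : ∀ k : ℕ,
    G s (k + 1) x → G (s.erase i) k x := by
  intro k
  induction k with
  | zero =>
    intro _ j hj
    obtain rfl : j = 0 := by omega
    rw [E_zero]; exact one_pos
  | succ k ih =>
    intro h
    have h0 := ih (fun j hj => h j (by omega))
    intro j hj
    rcases Nat.lt_or_ge j (k + 1) with hj' | hj'
    · exact h0 j (by omega)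
    obtain rfl : j = k + 1 := by omega
    have e0 := h0 k le_rfl
    have h1 := h (k + 1) (by omega)
    have h2 := h (k + 2) (by omega)
    rw [E_erase hi] at h1 h2
    have hN := newton (s.erase i) k x
    generalize esymmOn (s.erase i) (k + 2) x = a2 at *
    generalize esymmOn (s.erase i) (k + 1) x = a1 at *
    generalize esymmOn (s.erase i) k x = a0 at *
    by_contra hc
    push Not at hc
    -- a2 > - x a1, x a0 > -a1
    have h3 : 0 < (a2 + x i * a1) * a0 := mul_pos h2 e0
    have h4 : 0 ≤ (a1 + x i * a0) * (-a1) := mul_nonneg h1.le (by linarith)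
    nlinarith

lemma sq_div_sub {x y a b c : ℝ} (ha : 0 < a) (hb : 0 < b) (hc : a + b ≤ c) :
    (x + y) ^ 2 / c ≤ x ^ 2 / a + y ^ 2 / b := by
  have h1 : (x + y) ^ 2 / c ≤ (x + y) ^ 2 / (a + b) := by gcongr
  refine h1.trans ?_
  rw [div_add_div _ _ ha.ne' hb.ne', div_le_div_iff₀ (by positivity) (by positivity)]
  nlinarith [mul_nonneg (sq_nonneg (x * b - y * a)) (add_pos ha hb).le, sq_nonneg (x * b - y * a)]

lemma q_formula (s : Finset (Fin n)) (m : ℕ) (x : Fin n → ℝ) (h : G s (m + 1) x) :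
    esymmOn s (m + 2) x / esymmOn s (m + 1) x =
      (∑ i ∈ s, (x i - x i ^ 2 / (x i + esymmOn (s.erase i) (m + 1) x / esymmOn (s.erase i) m x)))
        / (m + 2) := by
  have hE := h (m + 1) le_rfl
  have := E_euler s x (m + 1)
  rw [eq_div_iff (by positivity), div_mul_eq_mul_div, div_eq_iff hE.ne', Finset.sum_mul]
  push_cast at this
  rw [mul_comm, show (m : ℝ) + 2 = m + 1 + 1 by ring, ← this]
  refine Finset.sum_congr rfl fun i hi => ?_
  have h0 := G_erase hi x m h m le_rfl
  have h1 := E_erase hi m x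
  rw [h1] at hE ⊢
  have : x i + esymmOn (s.erase i) (m + 1) x / esymmOn (s.erase i) m x =
    (esymmOn (s.erase i) (m + 1) x + x i * esymmOn (s.erase i) m x) / esymmOn (s.erase i) m x := by
    field_simp; ring
  rw [this]
  field_simp
  ring

lemma q_super : ∀ (m : ℕ) (s : Finset (Fin n)) (x y : Fin n → ℝ), G s m x → G s m y →
    G s m (x + y) ∧ esymmOn s (m + 1) x / esymmOn s m x + esymmOn s (m + 1) y / esymmOn s m y ≤
      esymmOn s (m + 1) (x + y) / esymmOn s m (x + y) := by
  intro m
  induction m with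
  | zero =>
    intro s x y _ _
    constructor
    · intro j hj
      obtain rfl : j = 0 := by omega
      rw [E_zero]; exact one_pos
    · simp [E_zero, esymmOn, Finset.powersetCard_one, Finset.sum_add_distrib]
  | succ m ih =>
    intro s x y hx hy
    obtain ⟨h1, h2⟩ := ih s x y (fun j hj => hx j (by omega)) (fun j hj => hy j (by omega))
    have hxy : G s (m + 1) (x + y) := by
      intro j hj
      rcases Nat.lt_or_ge j (m + 1) with hj' | hj'
      · exact h1 j (by omega)
      obtain rfl : j = m + 1 := by omega
      have a := div_pos (hx _ le_rfl) (hx m (by omega))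
      have b := div_pos (hy _ le_rfl) (hy m (by omega))
      have c : 0 < esymmOn s (m + 1) (x + y) / esymmOn s m (x + y) := by linarith
      exact (div_pos_iff_of_pos_right (h1 m le_rfl)).1 c
    refine ⟨hxy, ?_⟩
    rw [q_formula s m x hx, q_formula s m y hy, q_formula s m _ hxy, ← add_div,
      ← Finset.sum_add_distrib]
    gcongr with i hi
    have hpos : ∀ z : Fin n → ℝ, G s (m + 1) z →
        0 < z i + esymmOn (s.erase i) (m + 1) z / esymmOn (s.erase i) m z := by
      intro z hz
      have h0 := G_erase hi z m hz m le_rfl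
      have hE := hz (m + 1) le_rfl
      rw [E_erase hi] at hE
      have := div_pos hE h0
      rw [add_div, mul_div_assoc, div_self h0.ne'] at this
      linarith
    have h3 := (ih (s.erase i) x y (G_erase hi x m hx) (G_erase hi y m hy)).2
    have h4 := sq_div_sub (x := x i) (y := y i) (hpos x hx) (hpos y hy)
      (c := (x + y) i + esymmOn (s.erase i) (m + 1) (x + y) / esymmOn (s.erase i) m (x + y))
      (by simp only [Pi.add_apply]; linarith)
    simp only [Pi.add_apply] at h4 ⊢
    linarith

lemma gm_super (k : ℕ) (hk : 1 ≤ k) (a b c : ℕ → ℝ) (ha : ∀ j < k, 0 < a j)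
    (hb : ∀ j < k, 0 < b j) (hc : ∀ j < k, a j + b j ≤ c j) :
    (∏ j ∈ Finset.range k, a j) ^ ((1 : ℝ) / k) + (∏ j ∈ Finset.range k, b j) ^ ((1 : ℝ) / k) ≤
      (∏ j ∈ Finset.range k, c j) ^ ((1 : ℝ) / k) := by
  have hk0 : (0 : ℝ) < k := by exact_mod_cast hk
  have hcp : ∀ j < k, 0 < c j := fun j hj => by linarith [ha j hj, hb j hj, hc j hj]
  have hC : 0 < ∏ j ∈ Finset.range k, c j :=
    Finset.prod_pos fun j hj => hcp j (Finset.mem_range.1 hj)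
  have key : ∀ z : ℕ → ℝ, (∀ j < k, 0 < z j) →
      (∏ j ∈ Finset.range k, z j) ^ ((1 : ℝ) / k) / (∏ j ∈ Finset.range k, c j) ^ ((1 : ℝ) / k) ≤
        ∑ j ∈ Finset.range k, (1 : ℝ) / k * (z j / c j) := by
    intro z hz
    have := Real.geom_mean_le_arith_mean_weighted (Finset.range k) (fun _ => (1 : ℝ) / k)
      (fun j => z j / c j) (fun _ _ => by positivity) (by simp [hk0.ne'])
      (fun j hj => (div_pos (hz j (Finset.mem_range.1 hj)) (hcp j (Finset.mem_range.1 hj))).le)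
    refine le_trans (le_of_eq ?_) this
    rw [Real.finsetProd_rpow _ _
      (fun j hj => (div_pos (hz j (Finset.mem_range.1 hj)) (hcp j (Finset.mem_range.1 hj))).le),
      Finset.prod_div_distrib, Real.div_rpow _ hC.le]
    exact Finset.prod_nonneg fun j hj => (hz j (Finset.mem_range.1 hj)).le
  have h := add_le_add (key a ha) (key b hb)
  rw [← Finset.sum_add_distrib, ← add_div, div_le_iff₀ (Real.rpow_pos_of_pos hC _)] at h
  refine h.trans (mul_le_of_le_one_left (Real.rpow_pos_of_pos hC _).le ?_)
  calc _ ≤ ∑ j ∈ Finset.range k, (1 : ℝ) / k := by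
        refine Finset.sum_le_sum fun j hj => ?_
        have hj := Finset.mem_range.1 hj
        rw [← mul_add, ← add_div]
        refine mul_le_of_le_one_right (by positivity) ?_
        rw [div_le_one (hcp j hj)]; exact hc j hj
    _ = 1 := by simp [hk0.ne']

lemma E_prod (s : Finset (Fin n)) (x : Fin n → ℝ) : ∀ k : ℕ, G s k x →
    esymmOn s k x = ∏ j ∈ Finset.range k, esymmOn s (j + 1) x / esymmOn s j x := by
  intro k
  induction k with
  | zero => simp [E_zero]
  | succ k ih =>
    intro h
    rw [Finset.prod_range_succ, ← ih (fun j hj => h j (by omega))]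
    have := h k (by omega)
    field_simp

lemma mem_Gamma (k : ℕ) (x : Fin n → ℝ) : x ∈ Gamma n k ↔ G Finset.univ k x := by
  constructor
  · intro h j hj
    rcases Nat.eq_zero_or_pos j with rfl | h0
    · rw [E_zero]; exact one_pos
    · exact h j h0 hj
  · intro h j _ hj
    exact h j hj

/-- the function S_k^{1/k} -/
def F (n k : ℕ) (x : Fin n → ℝ) : ℝ := esymm' n k x ^ ((1 : ℝ) / k)

lemma Gamma_add {k : ℕ} {x y : Fin n → ℝ} (hx : x ∈ Gamma n k) (hy : y ∈ Gamma n k) :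
    x + y ∈ Gamma n k := by
  rw [mem_Gamma] at *
  exact (q_super k _ x y hx hy).1

lemma F_super {k : ℕ} (hk : 1 ≤ k) {x y : Fin n → ℝ} (hx : x ∈ Gamma n k) (hy : y ∈ Gamma n k) :
    F n k x + F n k y ≤ F n k (x + y) := by
  have hxy := Gamma_add hx hy
  rw [mem_Gamma] at *
  unfold F esymm'
  rw [E_prod _ x k hx, E_prod _ y k hy, E_prod _ _ k hxy]
  apply gm_super k hk
  · intro j hj; exact div_pos (hx _ (by omega)) (hx _ (by omega))
  · intro j hj; exact div_pos (hy _ (by omega)) (hy _ (by omega))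
  · intro j hj
    exact (q_super j _ x y (fun i hi => hx i (by omega)) (fun i hi => hy i (by omega))).2

lemma E_cont (k : ℕ) : Continuous (esymm' n k) := by
  unfold esymm' esymmOn
  fun_prop

lemma F_cont (k : ℕ) : Continuous (F n k) := by
  unfold F
  exact (E_cont k).rpow_const fun x => Or.inr (by positivity)

lemma K_add {k : ℕ} {x y : Fin n → ℝ} (hx : x ∈ closure (Gamma n k))
    (hy : y ∈ closure (Gamma n k)) : x + y ∈ closure (Gamma n k) :=
  map_mem_closure₂ continuous_add hx hy fun _ ha _ hb => Gamma_add ha hb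

lemma K_super {k : ℕ} (hk : 1 ≤ k) {x y : Fin n → ℝ} (hx : x ∈ closure (Gamma n k))
    (hy : y ∈ closure (Gamma n k)) : F n k x + F n k y ≤ F n k (x + y) := by
  have hcl : IsClosed {p : (Fin n → ℝ) × (Fin n → ℝ) |
      F n k p.1 + F n k p.2 ≤ F n k (p.1 + p.2)} := by
    have := F_cont (n := n) k
    apply isClosed_le <;> fun_prop
  have hsub : Gamma n k ×ˢ Gamma n k ⊆ {p : (Fin n → ℝ) × (Fin n → ℝ) |
      F n k p.1 + F n k p.2 ≤ F n k (p.1 + p.2)} := fun p hp => F_super hk hp.1 hp.2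
  have := closure_minimal hsub hcl
  rw [closure_prod_eq] at this
  exact this (Set.mk_mem_prod hx hy)

lemma E_smul (k : ℕ) (c : ℝ) (x : Fin n → ℝ) : esymm' n k (c • x) = c ^ k * esymm' n k x := by
  unfold esymm' esymmOn
  rw [Finset.mul_sum]
  refine Finset.sum_congr rfl fun t ht => ?_
  simp [Finset.prod_mul_distrib, (Finset.mem_powersetCard.1 ht).2]

lemma K_smul {k : ℕ} {c : ℝ} (hc : 0 < c) {x : Fin n → ℝ} (hx : x ∈ closure (Gamma n k)) :
    c • x ∈ closure (Gamma n k) := by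
  refine map_mem_closure (continuous_const_smul c) hx fun y hy j h1 h2 => ?_
  rw [E_smul]
  exact mul_pos (by positivity) (hy j h1 h2)

lemma K_nonneg {k : ℕ} (hk : 1 ≤ k) {x : Fin n → ℝ} (hx : x ∈ closure (Gamma n k)) :
    0 ≤ esymm' n k x := by
  have : closure (Gamma n k) ⊆ {x | 0 ≤ esymm' n k x} :=
    closure_minimal (fun y hy => (hy k hk le_rfl).le) (isClosed_le continuous_const (E_cont k))
  exact this hx

lemma F_smul {k : ℕ} (hk : 1 ≤ k) {c : ℝ} (hc : 0 < c) {x : Fin n → ℝ}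
    (hx : x ∈ closure (Gamma n k)) : F n k (c • x) = c * F n k x := by
  unfold F
  rw [E_smul, Real.mul_rpow (by positivity) (K_nonneg hk hx), one_div,
    Real.pow_rpow_inv_natCast hc.le (by omega)]

lemma F_concave {k : ℕ} (hk : 1 ≤ k) : ConcaveOn ℝ (closure (Gamma n k)) (F n k) := by
  rw [concaveOn_iff_forall_pos]
  constructor
  · rw [convex_iff_forall_pos]
    intro x hx y hy a b ha hb _
    exact K_add (K_smul ha hx) (K_smul hb hy)
  · intro x hx y hy a b ha hb _
    have := K_super hk (K_smul ha hx) (K_smul hb hy)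
    rw [F_smul hk ha hx, F_smul hk hb hy] at this
    exact this

lemma E_perm (k : ℕ) (σ : Equiv.Perm (Fin n)) (x : Fin n → ℝ) :
    esymm' n k (x ∘ σ) = esymm' n k x := by
  unfold esymm' esymmOn
  rw [← Finset.esymm_map_val, ← Finset.esymm_map_val]
  congr 1
  rw [← Multiset.map_map]
  congr 1
  have := congrArg Finset.val (Finset.map_univ_equiv σ)
  simpa using this

lemma K_perm {k : ℕ} (σ : Equiv.Perm (Fin n)) {x : Fin n → ℝ} (hx : x ∈ closure (Gamma n k)) :
    x ∘ σ ∈ closure (Gamma n k) := by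
  refine map_mem_closure (f := fun x : Fin n → ℝ => x ∘ σ)
    (continuous_pi fun i => continuous_apply (σ i)) hx fun y hy j h1 h2 => ?_
  rw [E_perm]
  exact hy j h1 h2

open Matrix in
lemma K_ds {k : ℕ} (hk : 1 ≤ k) {D : Matrix (Fin n) (Fin n) ℝ} (hD : D ∈ doublyStochastic ℝ (Fin n))
    {x : Fin n → ℝ} (hx : x ∈ closure (Gamma n k)) :
    D *ᵥ x ∈ closure (Gamma n k) ∧ F n k x ≤ F n k (D *ᵥ x) := by
  obtain ⟨w, hw, hw1, rfl⟩ := exists_eq_sum_perm_of_mem_doublyStochastic hD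
  have hc := F_concave (n := n) hk
  have e : (∑ σ, w σ • σ.permMatrix ℝ) *ᵥ x = ∑ σ, w σ • (x ∘ σ) := by
    rw [Matrix.sum_mulVec]
    refine Finset.sum_congr rfl fun σ _ => ?_
    rw [Matrix.smul_mulVec, Matrix.permMatrix_mulVec]
  rw [e]
  refine ⟨hc.1.sum_mem (fun σ _ => hw σ) hw1 (fun σ _ => K_perm σ hx), ?_⟩
  have := hc.le_map_sum (t := Finset.univ) (w := w) (p := fun σ : Equiv.Perm (Fin n) => x ∘ σ)
    (fun σ _ => hw σ) hw1 (fun σ _ => K_perm σ hx)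
  refine le_trans (le_of_eq ?_) this
  have h2 : ∀ σ : Equiv.Perm (Fin n), F n k (x ∘ σ) = F n k x := fun σ => by
    unfold F; rw [E_perm]
  simp only [h2, smul_eq_mul, ← Finset.sum_mul, hw1, one_mul]

open Matrix in
lemma diag_ds (A : Matrix (Fin n) (Fin n) ℂ) (hA : A.IsHermitian)
    (U : Matrix (Fin n) (Fin n) ℂ) (hU : U ∈ Matrix.unitaryGroup (Fin n) ℂ) :
    ∃ D ∈ doublyStochastic ℝ (Fin n), ∀ i,
      (star U * A * U) i i = (((D *ᵥ hA.eigenvalues) i : ℝ) : ℂ) := by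
  set V : Matrix (Fin n) (Fin n) ℂ := hA.eigenvectorUnitary.1 with hV
  have hVm : V ∈ Matrix.unitaryGroup (Fin n) ℂ := hA.eigenvectorUnitary.2
  set W := star U * V with hW
  have hWm : W ∈ Matrix.unitaryGroup (Fin n) ℂ := mul_mem (Unitary.star_mem hU) hVm
  have h1 := Matrix.mem_unitaryGroup_iff.1 hWm
  have h2 := Matrix.mem_unitaryGroup_iff'.1 hWm
  refine ⟨Matrix.of fun i j => Complex.normSq (W i j), ?_, ?_⟩
  · rw [mem_doublyStochastic_iff_sum]
    simp only [Matrix.of_apply]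
    refine ⟨fun i j => Complex.normSq_nonneg _, fun i => ?_, fun j => ?_⟩
    · have := congrFun (congrFun h1 i) i
      rw [Matrix.mul_apply, Matrix.one_apply_eq] at this
      simp only [Matrix.star_apply, Complex.star_def, Complex.mul_conj] at this
      exact_mod_cast this
    · have := congrFun (congrFun h2 j) j
      rw [Matrix.mul_apply, Matrix.one_apply_eq] at this
      simp only [Matrix.star_apply, Complex.star_def, ← Complex.normSq_eq_conj_mul_self] at this
      exact_mod_cast this
  · intro i
    have hs := hA.spectral_theorem
    rw [Unitary.conjStarAlgAut_apply] at hs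
    have e : star U * A * U = W * diagonal (RCLike.ofReal ∘ hA.eigenvalues) * star W := by
      conv_lhs => rw [hs]
      rw [hW, star_mul, star_star]
      simp only [Matrix.mul_assoc, hV]
    rw [e, Matrix.mul_apply]
    simp only [Matrix.mul_diagonal, Matrix.star_apply, Matrix.mulVec, dotProduct, Matrix.of_apply]
    push_cast
    refine Finset.sum_congr rfl fun j _ => ?_
    rw [← Complex.mul_conj]
    simp
    ring

end helpers

/-- Superadditivity of `S_k^{1/k}` on Hermitian matrices with eigenvalues in `Γ̄_k`. -/
theorem stmt_5 (n k : ℕ) (hk : 1 ≤ k) (hkn : k ≤ n)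
    (A B : Matrix (Fin n) (Fin n) ℂ) (hA : A.IsHermitian) (hB : B.IsHermitian)
    (hlA : hA.eigenvalues ∈ closure (Gamma n k))
    (hlB : hB.eigenvalues ∈ closure (Gamma n k)) :
    esymm' n k hA.eigenvalues ^ ((1 : ℝ) / k) + esymm' n k hB.eigenvalues ^ ((1 : ℝ) / k)
      ≤ esymm' n k (hA.add hB).eigenvalues ^ ((1 : ℝ) / k) := by
  set U : Matrix (Fin n) (Fin n) ℂ := (hA.add hB).eigenvectorUnitary.1 with hU
  have hUm : U ∈ Matrix.unitaryGroup (Fin n) ℂ := (hA.add hB).eigenvectorUnitary.2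
  obtain ⟨D1, hD1, h1⟩ := diag_ds A hA U hUm
  obtain ⟨D2, hD2, h2⟩ := diag_ds B hB U hUm
  obtain ⟨k1, f1⟩ := K_ds hk hD1 hlA
  obtain ⟨k2, f2⟩ := K_ds hk hD2 hlB
  have h3 := K_super hk k1 k2
  have e : (hA.add hB).eigenvalues = D1.mulVec hA.eigenvalues + D2.mulVec hB.eigenvalues := by
    funext i
    have hs := (hA.add hB).spectral_theorem
    rw [Unitary.conjStarAlgAut_apply, ← hU] at hs
    have hUU := Matrix.mem_unitaryGroup_iff'.1 hUm
    have : star U * (A + B) * U = Matrix.diagonal (RCLike.ofReal ∘ (hA.add hB).eigenvalues) := by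
      conv_lhs => rw [hs]
      calc _ = (star U * U) * Matrix.diagonal (RCLike.ofReal ∘ (hA.add hB).eigenvalues)
            * (star U * U) := by simp only [Matrix.mul_assoc]
        _ = _ := by rw [hUU, Matrix.one_mul, Matrix.mul_one]
    rw [Matrix.mul_add, Matrix.add_mul] at this
    have h := congrFun (congrFun this i) i
    rw [Matrix.add_apply, h1, h2, Matrix.diagonal_apply_eq] at h
    have h' : (((D1.mulVec hA.eigenvalues) i + (D2.mulVec hB.eigenvalues) i : ℝ) : ℂ)
      = (((hA.add hB).eigenvalues i : ℝ) : ℂ) := by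
      push_cast; exact h
    exact (Complex.ofReal_injective h').symm
  change F n k _ + F n k _ ≤ F n k _
  rw [e]
  linarith
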